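/- Let W be a subspace of V. For every m ∈ ℕ there exist a unique vector w ∈ W and a unique finitely supported family of scalars (a_n) indexed by {n ∈ S(W) : n ≤ m} such that e_m = w + Σ_{n ∈ S(W), n ≤ m} a_n e_n. -/

import Mathlib

/-- The index set `S(W)` of the formal-basis-style complement, defined by strong
recursion: `n ∈ S(W)` iff `e n ∉ W + span {e k : k ∈ S(W), k < n}`. -/
noncomputable def formalBasisIndexSet {𝔽 V : Type*} [Field 𝔽] [AddCommGroup V] [Module 𝔽 V]
    (e : ℕ → V) (W : Submodule 𝔽 V) (n : ℕ) : Prop :=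
  Nat.strongRecOn (motive := fun _ => Prop) n (fun n ih =>
    e n ∉ W ⊔ Submodule.span 𝔽 {v | ∃ k, ∃ h : k < n, ih k h ∧ v = e k})

/-- The formal-basis-style complement `C(W) = span {e n : n ∈ S(W)}`. -/
noncomputable def formalBasisComplement {𝔽 V : Type*} [Field 𝔽] [AddCommGroup V] [Module 𝔽 V]
    (e : ℕ → V) (W : Submodule 𝔽 V) : Submodule 𝔽 V :=
  Submodule.span 𝔽 (e '' {n | formalBasisIndexSet e W n})

theorem formalBasisIndexSet_iff {𝔽 V : Type*} [Field 𝔽] [AddCommGroup V] [Module 𝔽 V]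
    (e : ℕ → V) (W : Submodule 𝔽 V) (n : ℕ) :
    formalBasisIndexSet e W n ↔
      e n ∉ W ⊔ Submodule.span 𝔽 (e '' {k | formalBasisIndexSet e W k ∧ k < n}) := by
  have image_eq : e '' {k | formalBasisIndexSet e W k ∧ k < n} =
      {v | ∃ k, ∃ _ : k < n, formalBasisIndexSet e W k ∧ v = e k} := by
    ext v
    constructor
    · rintro ⟨k, ⟨hk, hlt⟩, rfl⟩
      exact ⟨k, hlt, hk, rfl⟩
    · rintro ⟨k, hlt, hk, rfl⟩
      exact ⟨k, ⟨hk, hlt⟩, rfl⟩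
  rw [image_eq]
  conv_lhs => unfold formalBasisIndexSet
  rw [Nat.strongRecOn_eq]
  rfl

/-- The vectors `e n` with `n ∈ S(W)` are linearly independent modulo `W`. -/
theorem eq_zero_of_linearCombination_mem {𝔽 V : Type*} [Field 𝔽] [AddCommGroup V] [Module 𝔽 V]
    (e : ℕ → V) (W : Submodule 𝔽 V) (f : ℕ →₀ 𝔽)
    (hf : ∀ n ∈ f.support, formalBasisIndexSet e W n)
    (hW : Finsupp.linearCombination 𝔽 e f ∈ W) : f = 0 := by
  by_contra hne
  have hsupp : f.support.Nonempty := Finsupp.support_nonempty_iff.mpr hne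
  set n := f.support.max' hsupp
  have hn : n ∈ f.support := f.support.max'_mem hsupp
  have hrest : Finsupp.linearCombination 𝔽 e (f.erase n) ∈
      Submodule.span 𝔽 (e '' {k | formalBasisIndexSet e W k ∧ k < n}) := by
    refine (Finsupp.mem_span_image_iff_linearCombination 𝔽).mpr ⟨f.erase n, ?_, rfl⟩
    refine (Finsupp.mem_supported 𝔽 _).mpr fun k hk => ?_
    rw [Finset.mem_coe, Finsupp.support_erase, Finset.mem_erase] at hk
    exact ⟨hf k hk.2, lt_of_le_of_ne (f.support.le_max' k hk.2) hk.1⟩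
  have hsplit : f n • e n =
      Finsupp.linearCombination 𝔽 e f - Finsupp.linearCombination 𝔽 e (f.erase n) := by
    conv_rhs => enter [1]; rw [← Finsupp.single_add_erase n f]
    rw [map_add, Finsupp.linearCombination_single, add_sub_cancel_right]
  refine (formalBasisIndexSet_iff e W n).mp (hf n hn) ?_
  refine (Submodule.smul_mem_iff _ (Finsupp.mem_support_iff.mp hn)).mp ?_
  rw [hsplit]
  exact sub_mem (Submodule.mem_sup_left hW) (Submodule.mem_sup_right hrest)

theorem exists_representation {𝔽 V : Type*} [Field 𝔽] [AddCommGroup V] [Module 𝔽 V]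
    (e : ℕ → V) (W : Submodule 𝔽 V) (m : ℕ) :
    ∃ w ∈ W, ∃ f : ℕ →₀ 𝔽, (∀ n ∈ f.support, formalBasisIndexSet e W n ∧ n ≤ m) ∧
      e m = w + Finsupp.linearCombination 𝔽 e f := by
  by_cases hm : formalBasisIndexSet e W m
  · refine ⟨0, W.zero_mem, Finsupp.single m 1, fun n hn => ?_, by simp⟩
    obtain rfl := Finset.mem_singleton.mp (Finsupp.support_single_subset hn)
    exact ⟨hm, le_rfl⟩
  · rw [formalBasisIndexSet_iff, not_not] at hm
    obtain ⟨w, hw, v, hv, hsum⟩ := Submodule.mem_sup.mp hm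
    obtain ⟨f, hf, rfl⟩ := (Finsupp.mem_span_image_iff_linearCombination 𝔽).mp hv
    exact ⟨w, hw, f, fun n hn => ⟨(hf hn).1, (hf hn).2.le⟩, hsum.symm⟩

/-- Every basis vector `e m` has a unique representation `e m = w + ∑_{n ∈ S(W), n ≤ m} a_n • e n`
with `w ∈ W` and scalars `a_n` supported on `{n ∈ S(W) : n ≤ m}`. -/
theorem formalBasis_unique_representation {𝔽 V : Type*} [Field 𝔽] [AddCommGroup V] [Module 𝔽 V]
    (b : Module.Basis ℕ 𝔽 V) (W : Submodule 𝔽 V) (m : ℕ) :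
    ∃! p : W × (ℕ →₀ 𝔽),
      (∀ n ∈ p.2.support, formalBasisIndexSet ⇑b W n ∧ n ≤ m) ∧
      b m = (p.1 : V) + p.2.sum fun n c => c • b n := by
  obtain ⟨w, hw, f, hf, hrep⟩ := exists_representation (⇑b) W m
  refine ⟨(⟨w, hw⟩, f), ⟨hf, hrep⟩, ?_⟩
  rintro ⟨w', g⟩ ⟨hg, hrep'⟩
  change b m = (w' : V) + Finsupp.linearCombination 𝔽 b g at hrep'
  have hdiff : Finsupp.linearCombination 𝔽 b (g - f) = w - w' := by
    rw [map_sub, sub_eq_sub_iff_add_eq_add, add_comm, ← hrep', hrep]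
  have hgf : g = f := by
    refine sub_eq_zero.mp (eq_zero_of_linearCombination_mem (⇑b) W (g - f) (fun n hn => ?_) ?_)
    · rcases Finset.mem_union.mp (Finsupp.support_sub hn) with h | h
      · exact (hg n h).1
      · exact (hf n h).1
    · rw [hdiff]
      exact sub_mem hw w'.2
  subst hgf
  rw [hrep] at hrep'
  exact Prod.ext (Subtype.ext (add_right_cancel hrep').symm) rfl
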